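/- arXiv:1707.03379 — 2 statements merged into one kernel-verified Lean document; each statement's English description precedes it below -/
import Mathlib

section
/- For every nonnegative integer n, the number of partitions of 5n + 4 is divisible by 5, i.e., p(5n + 4) ≡ 0 (mod 5). -/
open PowerSeries Finset

/-- All exponents of monomials occurring in `f` lie in the residue class `r` modulo `m`. -/
def PowerSeries.IsSupportedMod {R : Type*} [Semiring R] {m : ℕ} (r : ZMod m) (f : R⟦X⟧) : Prop :=
  ∀ n : ℕ, coeff n f ≠ 0 → (n : ZMod m) = r

namespace PowerSeries.IsSupportedMod

variable {R : Type*} [Semiring R] {m : ℕ} {r s : ZMod m} {f g : R⟦X⟧}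

theorem coeff_eq_zero (hf : IsSupportedMod r f) {n : ℕ} (hn : (n : ZMod m) ≠ r) :
    coeff n f = 0 := by
  by_contra h
  exact hn (hf n h)

theorem add (hf : IsSupportedMod r f) (hg : IsSupportedMod r g) : IsSupportedMod r (f + g) := by
  intro n hn
  by_contra h
  exact hn (by rw [map_add, hf.coeff_eq_zero h, hg.coeff_eq_zero h, add_zero])

theorem mul (hf : IsSupportedMod r f) (hg : IsSupportedMod s g) :
    IsSupportedMod (r + s) (f * g) := by
  intro n hn
  rw [coeff_mul] at hn
  obtain ⟨⟨i, j⟩, hij, h⟩ := exists_ne_zero_of_sum_ne_zero hn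
  rw [HasAntidiagonal.mem_antidiagonal] at hij
  rw [← hij, Nat.cast_add, hf i (left_ne_zero_of_mul h), hg j (right_ne_zero_of_mul h)]

theorem one : IsSupportedMod (0 : ZMod m) (1 : R⟦X⟧) := by
  intro n hn
  have : n = 0 := by
    by_contra h
    exact hn (by simp [coeff_one, h])
  simp [this]

theorem pow (hf : IsSupportedMod r f) (k : ℕ) : IsSupportedMod ((k : ZMod m) * r) (f ^ k) := by
  induction k with
  | zero => simpa using one
  | succ k ih => simpa [pow_succ, add_mul] using ih.mul hf

end PowerSeries.IsSupportedMod

theorem PowerSeries.isSupportedMod_pow_char {R : Type*} [CommRing R] {p : ℕ} [ExpChar R p]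
    (f : R⟦X⟧) : IsSupportedMod (0 : ZMod p) (f ^ p) := by
  intro n hn
  have hp : p ≠ 0 := expChar_ne_zero R p
  have h : PowerSeries.map (frobenius R p) (f.expand p hp) = f ^ p :=
    MvPowerSeries.map_frobenius_expand p hp
  rw [ZMod.natCast_eq_zero_iff]
  by_contra hd
  exact hn (by rw [← h, coeff_map, coeff_expand_of_not_dvd p hp _ hd, map_zero])

theorem abs_le_pentagonal (k : ℤ) : |k| ≤ pentagonal k := by
  have h := two_mul_natCast_pentagonal k
  rcases le_or_gt k 0 with hk | hk
  · rw [abs_of_nonpos hk]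
    nlinarith
  · rw [abs_of_pos hk]
    nlinarith

theorem mem_Icc_of_pentagonal_le {k : ℤ} {n : ℕ} (h : pentagonal k ≤ n) :
    k ∈ Icc (-n : ℤ) n := by
  have := (abs_le_pentagonal k).trans (Nat.cast_le.mpr h)
  rw [mem_Icc]
  exact abs_le.mp this

namespace PowerSeries

variable (R : Type*) [CommRing R]

/-- The part of the pentagonal series indexed by the integers congruent to `r` modulo `m`. -/
noncomputable def pentagonalPart {m : ℕ} (r : ZMod m) : R⟦X⟧ :=
  .mk fun n ↦ ∑ k ∈ Icc (-n : ℤ) n with pentagonal k = n ∧ (k : ZMod m) = r,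
    ((Int.negOnePow k : ℤ) : R)

theorem coeff_pentagonalPart {m : ℕ} (r : ZMod m) {n N : ℕ} (h : n ≤ N) :
    coeff n (pentagonalPart R r) =
      ∑ k ∈ Icc (-N : ℤ) N, if pentagonal k = n ∧ (k : ZMod m) = r then
        ((Int.negOnePow k : ℤ) : R) else 0 := by
  rw [pentagonalPart, coeff_mk, ← sum_filter]
  refine sum_congr ?_ fun _ _ ↦ rfl
  ext k
  simp only [mem_filter, and_congr_left_iff]
  intro hk
  exact iff_of_true (mem_Icc_of_pentagonal_le hk.1.le) (mem_Icc_of_pentagonal_le (hk.1.le.trans h))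

theorem sum_pentagonalPart (m : ℕ) [NeZero m] :
    ∑ r : ZMod m, pentagonalPart R r = pentagonalSeries R := by
  ext n
  simp_rw [map_sum, coeff_pentagonalPart R _ le_rfl]
  rw [sum_comm]
  simp_rw [ite_and]
  have (k : ℤ) : (∑ r : ZMod m, if pentagonal k = n then
      (if (k : ZMod m) = r then ((Int.negOnePow k : ℤ) : R) else 0) else 0) =
      if pentagonal k = n then ((Int.negOnePow k : ℤ) : R) else 0 := by
    split_ifs <;> simp
  simp_rw [this]
  by_cases hn : n ∈ Set.range pentagonal
  · obtain ⟨k, rfl⟩ := hn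
    rw [coeff_pentagonalSeries_pentagonal, sum_eq_single k]
    · simp
    · intro l _ hl
      simp [hl]
    · intro h
      exact absurd (mem_Icc_of_pentagonal_le le_rfl) h
  · rw [coeff_pentagonalSeries_eq_zero R hn]
    exact sum_eq_zero fun k _ ↦ if_neg fun h ↦ hn ⟨k, h⟩

theorem isSupportedMod_pentagonalPart {r s : ZMod 5} (h : 3 * (r * (3 * r - 1)) = s) :
    IsSupportedMod s (pentagonalPart R r) := by
  intro n hn
  rw [pentagonalPart, coeff_mk] at hn
  obtain ⟨k, hk, -⟩ := exists_ne_zero_of_sum_ne_zero hn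
  obtain ⟨-, rfl, rfl⟩ := mem_filter.mp hk
  have h2 := congrArg (Int.cast : ℤ → ZMod 5) (two_mul_natCast_pentagonal k)
  push_cast at h2
  have h5 : (5 : ZMod 5) = 0 := rfl
  linear_combination 3 * h2 + h - (pentagonal k : ZMod 5) * h5

theorem coeff_pentagonalPart_mul {m : ℕ} (r s : ZMod m) (n : ℕ) :
    coeff n (pentagonalPart R r * pentagonalPart R s) =
      ∑ p ∈ Icc (-n : ℤ) n ×ˢ Icc (-n : ℤ) n,
        if pentagonal p.1 + pentagonal p.2 = n ∧ (p.1 : ZMod m) = r ∧ (p.2 : ZMod m) = s then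
          ((Int.negOnePow (p.1 + p.2) : ℤ) : R) else 0 := by
  have (ij : ℕ × ℕ) (h : ij ∈ antidiagonal n) :
      coeff ij.1 (pentagonalPart R r) * coeff ij.2 (pentagonalPart R s) =
      ∑ p ∈ Icc (-n : ℤ) n ×ˢ Icc (-n : ℤ) n, if (pentagonal p.1, pentagonal p.2) = ij then
        (if (p.1 : ZMod m) = r ∧ (p.2 : ZMod m) = s then
          ((Int.negOnePow (p.1 + p.2) : ℤ) : R) else 0) else 0 := by
    rw [HasAntidiagonal.mem_antidiagonal] at h
    rw [coeff_pentagonalPart R r (N := n) (by lia), coeff_pentagonalPart R s (N := n) (by lia),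
      sum_mul_sum, sum_product]
    refine sum_congr rfl fun k _ ↦ sum_congr rfl fun l _ ↦ ?_
    simp only [Int.negOnePow_add, Prod.ext_iff]
    push_cast
    split_ifs <;> first | rfl | (exfalso; tauto) | simp
  rw [coeff_mul, sum_congr rfl this, sum_comm]
  refine sum_congr rfl fun p _ ↦ ?_
  simp only [sum_ite_eq, ite_and, HasAntidiagonal.mem_antidiagonal]

/-- Writing `x = 6k - 1` and `y = 6l - 1`, the terms of the double sum correspond to the Gaussian
integers `x + iy` with `y ≡ 2x` modulo `5`. These are paired off, with opposite signs, by a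
reflection of the plane. -/
theorem sum_pentagonalPart_mul_pentagonalPart :
    ∑ r : ZMod 5, pentagonalPart R r * pentagonalPart R (2 * r - 1) = 0 := by
  ext n
  simp_rw [map_sum, coeff_pentagonalPart_mul, map_zero]
  rw [sum_comm]
  have (p : ℤ × ℤ) : (∑ r : ZMod 5, if pentagonal p.1 + pentagonal p.2 = n ∧
      (p.1 : ZMod 5) = r ∧ (p.2 : ZMod 5) = 2 * r - 1 then
        ((Int.negOnePow (p.1 + p.2) : ℤ) : R) else 0) =
      if pentagonal p.1 + pentagonal p.2 = n ∧ (5 : ℤ) ∣ p.2 - 2 * p.1 + 1 then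
        ((Int.negOnePow (p.1 + p.2) : ℤ) : R) else 0 := by
    have h : (p.2 : ZMod 5) = 2 * p.1 - 1 ↔ (5 : ℤ) ∣ p.2 - 2 * p.1 + 1 := by
      rw [← sub_eq_zero]
      have := ZMod.intCast_zmod_eq_zero_iff_dvd (p.2 - 2 * p.1 + 1) 5
      push_cast at this
      rw [← this]
      ring_nf
    rw [sum_eq_single (p.1 : ZMod 5)]
    · simp [h]
    · intro r _ hr
      exact if_neg fun h ↦ hr h.2.1.symm
    · simp
  simp_rw [this]
  rw [← sum_filter]
  refine sum_involution (fun p _ ↦ (1 - p.1 - 4 * ((p.2 - 2 * p.1 + 1) / 5),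
    1 - 2 * p.1 - 3 * ((p.2 - 2 * p.1 + 1) / 5))) ?_ ?_ ?_ ?_
  · rintro ⟨k, l⟩ hp
    obtain ⟨-, -, s, hs⟩ := mem_filter.mp hp
    obtain rfl : l = 2 * k - 1 + 5 * s := by dsimp only at hs; lia
    dsimp only
    rw [hs, Int.mul_ediv_cancel_left _ (by norm_num),
      show 1 - k - 4 * s + (1 - 2 * k - 3 * s) =
        (k + (2 * k - 1 + 5 * s)) + (2 * (1 - 3 * k - 6 * s) + 1) by ring,
      Int.negOnePow_add _ (2 * (1 - 3 * k - 6 * s) + 1), Int.negOnePow_two_mul_add_one]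
    simp
  · rintro ⟨k, l⟩ hp -
    obtain ⟨-, -, s, hs⟩ := mem_filter.mp hp
    dsimp only at hs ⊢
    rw [hs, Int.mul_ediv_cancel_left _ (by norm_num), ne_eq, Prod.ext_iff]
    dsimp only
    lia
  · rintro ⟨k, l⟩ hp
    obtain ⟨-, hn, s, hs⟩ := mem_filter.mp hp
    obtain rfl : l = 2 * k - 1 + 5 * s := by dsimp only at hs; lia
    dsimp only at hn ⊢
    rw [hs, Int.mul_ediv_cancel_left _ (by norm_num)]
    have hn' : pentagonal (1 - k - 4 * s) + pentagonal (1 - 2 * k - 3 * s) = n := by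
      have h1 := two_mul_natCast_pentagonal k
      have h2 := two_mul_natCast_pentagonal (2 * k - 1 + 5 * s)
      have h3 := two_mul_natCast_pentagonal (1 - k - 4 * s)
      have h4 := two_mul_natCast_pentagonal (1 - 2 * k - 3 * s)
      zify at hn ⊢
      linarith
    rw [mem_filter, mem_product]
    refine ⟨⟨mem_Icc_of_pentagonal_le ?_, mem_Icc_of_pentagonal_le ?_⟩, hn', s, ?_⟩
    · dsimp only
      lia
    · dsimp only
      lia
    · ring
  · rintro ⟨k, l⟩ hp
    obtain ⟨-, -, s, hs⟩ := mem_filter.mp hp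
    dsimp only at hs ⊢
    rw [hs, Int.mul_ediv_cancel_left _ (by norm_num),
      show 1 - 2 * k - 3 * s - 2 * (1 - k - 4 * s) + 1 = 5 * s by ring,
      Int.mul_ediv_cancel_left _ (by norm_num), Prod.ext_iff]
    dsimp only
    lia

open scoped PowerSeries.WithPiTopology in
theorem powerSeriesMk_card_partition_mul_pentagonalSeries :
    (PowerSeries.mk fun n ↦ (Fintype.card (Nat.Partition n) : R)) * pentagonalSeries R = 1 := by
  let _ : TopologicalSpace R := ⊥
  have _ : DiscreteTopology R := ⟨rfl⟩
  have h := (Nat.Partition.hasProd_powerSeriesMk_card_restricted R fun _ ↦ True).mul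
    (WithPiTopology.hasProd_one_sub_X_pow R)
  have h1 (i : ℕ) : (∑' j : ℕ, (X : R⟦X⟧) ^ ((i + 1) * j)) * (1 - X ^ (i + 1)) = 1 := by
    simp_rw [pow_mul]
    exact WithPiTopology.tsum_pow_mul_one_sub_of_constantCoeff_eq_zero (by simp)
  simp only [if_true, h1] at h
  simpa [Nat.Partition.restricted] using h.unique hasProd_one

end PowerSeries

theorem ramanujan_congruence_mod_five (n : ℕ) :
    5 ∣ Fintype.card (Nat.Partition (5 * n + 4)) := by
  have : Fact (Nat.Prime 5) := ⟨Nat.prime_five⟩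
  rw [← ZMod.natCast_eq_zero_iff]
  set P : (ZMod 5)⟦X⟧ := .mk fun n ↦ (Fintype.card (Nat.Partition n) : ZMod 5) with hP
  set θ : ZMod 5 → (ZMod 5)⟦X⟧ := pentagonalPart (ZMod 5) with hθ
  have hPE := powerSeriesMk_card_partition_mul_pentagonalSeries (ZMod 5)
  rw [← hP, ← sum_pentagonalPart (ZMod 5) 5, ← hθ] at hPE
  have hrel := sum_pentagonalPart_mul_pentagonalPart (ZMod 5)
  rw [← hθ] at hrel
  have huniv (f : ZMod 5 → (ZMod 5)⟦X⟧) : ∑ r, f r = f 0 + f 1 + f 2 + f 3 + f 4 :=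
    Fin.sum_univ_five f
  rw [huniv] at hPE hrel
  rw [show (2 * 0 - 1 : ZMod 5) = 4 from rfl, show (2 * 1 - 1 : ZMod 5) = 1 from rfl,
    show (2 * 2 - 1 : ZMod 5) = 3 from rfl, show (2 * 3 - 1 : ZMod 5) = 0 from rfl,
    show (2 * 4 - 1 : ZMod 5) = 2 from rfl] at hrel
  have ha : IsSupportedMod (0 : ZMod 5) (θ 0 + θ 2) :=
    (isSupportedMod_pentagonalPart _ rfl).add (isSupportedMod_pentagonalPart _ rfl)
  have hb : IsSupportedMod (1 : ZMod 5) (θ 1) := isSupportedMod_pentagonalPart _ rfl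
  have hc : IsSupportedMod (2 : ZMod 5) (θ 3 + θ 4) :=
    (isSupportedMod_pentagonalPart _ rfl).add (isSupportedMod_pentagonalPart _ rfl)
  have hac : (θ 0 + θ 2) * (θ 3 + θ 4) + θ 1 ^ 2 = 0 := by linear_combination hrel
  have hE : P * (θ 0 + θ 2 + θ 1 + (θ 3 + θ 4)) = 1 := by linear_combination hPE
  generalize θ 0 + θ 2 = a at *
  generalize θ 1 = b at *
  generalize θ 3 + θ 4 = c at *
  have h5 : (5 : (ZMod 5)⟦X⟧) = 0 := by
    rw [← map_ofNat (C (R := ZMod 5)) 5, show (OfNat.ofNat 5 : ZMod 5) = 0 from rfl, map_zero]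
  have hmul : P ^ 5 * (a + b + c) ^ 4 = P := by
    rw [show P ^ 5 * (a + b + c) ^ 4 = P * (P * (a + b + c)) ^ 4 by ring, hE]
    ring
  have hmon (i j k : ℕ) (hijk : (j + k * 2) % 5 ≠ 4) (u : ℕ) :
      coeff (5 * n + 4) (u • (P ^ 5 * (a ^ i * b ^ j * c ^ k))) = 0 := by
    rw [map_nsmul, ((isSupportedMod_pow_char P).mul
      (((ha.pow i).mul (hb.pow j)).mul (hc.pow k))).coeff_eq_zero, smul_zero]
    have h : ((5 * n + 4 : ℕ) : ZMod 5) ≠ ((j + k * 2 : ℕ) : ZMod 5) := by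
      rw [ne_eq, ZMod.natCast_eq_natCast_iff']
      lia
    simpa using h
  have hsum : P = 1 • (P ^ 5 * (a ^ 4 * b ^ 0 * c ^ 0)) + 4 • (P ^ 5 * (a ^ 3 * b ^ 1 * c ^ 0))
      + 4 • (P ^ 5 * (a ^ 3 * b ^ 0 * c ^ 1)) + 6 • (P ^ 5 * (a ^ 2 * b ^ 2 * c ^ 0))
      + 12 • (P ^ 5 * (a ^ 2 * b ^ 1 * c ^ 1)) + 4 • (P ^ 5 * (a ^ 1 * b ^ 3 * c ^ 0))
      + 12 • (P ^ 5 * (a ^ 1 * b ^ 1 * c ^ 2)) + 4 • (P ^ 5 * (a ^ 1 * b ^ 0 * c ^ 3))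
      + 4 • (P ^ 5 * (a ^ 0 * b ^ 3 * c ^ 1)) + 6 • (P ^ 5 * (a ^ 0 * b ^ 2 * c ^ 2))
      + 4 • (P ^ 5 * (a ^ 0 * b ^ 1 * c ^ 3)) + 1 • (P ^ 5 * (a ^ 0 * b ^ 0 * c ^ 4)) := by
    simp only [nsmul_eq_mul]
    push_cast
    linear_combination -hmul + P ^ 5 * (6 * a * c + 6 * b ^ 2) * hac - P ^ 5 * b ^ 4 * h5
  have hcoeff := congrArg (coeff (5 * n + 4)) hsum
  simp only [map_add] at hcoeff
  rw [hmon 4 0 0 (by decide), hmon 3 1 0 (by decide), hmon 3 0 1 (by decide),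
    hmon 2 2 0 (by decide), hmon 2 1 1 (by decide), hmon 1 3 0 (by decide),
    hmon 1 1 2 (by decide), hmon 1 0 3 (by decide), hmon 0 3 1 (by decide),
    hmon 0 2 2 (by decide), hmon 0 1 3 (by decide), hmon 0 0 4 (by decide)] at hcoeff
  simpa [hP] using hcoeff
end

section
/- For every nonnegative integer n, the number of partitions of 7n + 5 is divisible by 7, i.e., p(7n + 5) ≡ 0 (mod 7). -/
open PowerSeries Finset

section JacobiIdentity

variable (R : Type*) [CommRing R]

/-- The finite Euler product `∏_{1 ≤ i ≤ m} (1 - X ^ i)`. -/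
noncomputable def eulerProd (m : ℕ) : R⟦X⟧ := ∏ i ∈ range m, (1 - X ^ (i + 1))

lemma eulerProd_zero : eulerProd R 0 = 1 := prod_range_zero _

lemma eulerProd_succ (m : ℕ) : eulerProd R (m + 1) = eulerProd R m * (1 - X ^ (m + 1)) :=
  prod_range_succ _ _

/-- The coefficient of `z ^ k` in
`∏_{1 ≤ i ≤ n} (1 - z * X ^ i) * ∏_{0 ≤ i ≤ n} (1 - z⁻¹ * X ^ i)`, for `0 ≤ k`. -/
noncomputable def tripleCoeff : ℕ → ℕ → R⟦X⟧
  | 0, 0 => 1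
  | 0, _ + 1 => 0
  | n + 1, 0 =>
    (1 + X ^ (2 * n + 2)) * tripleCoeff n 0 + X ^ (n + 1) * (tripleCoeff n 0 - tripleCoeff n 1)
  | n + 1, k + 1 =>
    (1 + X ^ (2 * n + 2)) * tripleCoeff n (k + 1) -
      X ^ (n + 1) * (tripleCoeff n k + tripleCoeff n (k + 2))

lemma tripleCoeff_eq_zero {n k : ℕ} (h : n < k) : tripleCoeff R n k = 0 := by
  induction n generalizing k with
  | zero => obtain ⟨k, rfl⟩ := Nat.exists_eq_add_one_of_ne_zero h.ne'; rw [tripleCoeff]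
  | succ n ih =>
    obtain ⟨k, rfl⟩ := Nat.exists_eq_add_one_of_ne_zero (by omega : k ≠ 0)
    rw [tripleCoeff, ih (by omega), ih (by omega), ih (by omega)]
    ring

/-- Summing the recursion for `tripleCoeff` against the weights `2 * k + 1`, with boundary terms. -/
lemma sum_mul_tripleCoeff_succ (n N : ℕ) :
    ∑ k ∈ range (N + 1), (2 * k + 1 : R⟦X⟧) * tripleCoeff R (n + 1) k =
      (1 - X ^ (n + 1)) ^ 2 * ∑ k ∈ range (N + 1), (2 * k + 1 : R⟦X⟧) * tripleCoeff R n k +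
      X ^ (n + 1) * ((2 * (N : R⟦X⟧) + 3) * tripleCoeff R n N - (2 * (N : R⟦X⟧) + 1) * tripleCoeff R n (N + 1)) := by
  induction N with
  | zero => simp [tripleCoeff]; ring
  | succ N ih =>
    rw [sum_range_succ, ih, sum_range_succ _ (N + 1), tripleCoeff]
    push_cast
    ring

lemma sum_mul_tripleCoeff {n N : ℕ} (h : n ≤ N) :
    ∑ k ∈ range (N + 1), (2 * k + 1 : R⟦X⟧) * tripleCoeff R n k = eulerProd R n ^ 2 := by
  induction n with
  | zero =>
    rw [sum_range_succ', sum_eq_zero fun k _ ↦ by rw [tripleCoeff, mul_zero]]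
    simp [tripleCoeff, eulerProd_zero]
  | succ n ih =>
    rw [sum_mul_tripleCoeff_succ, ih (by omega), tripleCoeff_eq_zero R (by omega : n < N),
      tripleCoeff_eq_zero R (by omega : n < N + 1), eulerProd_succ]
    ring

lemma succ_succ_choose_two (k : ℕ) : (k + 2).choose 2 = (k + 1).choose 2 + (k + 1) := by
  rw [Nat.choose_succ_succ' (k + 1) 1, Nat.choose_one_right, add_comm]

/-- `tripleCoeff` is, up to sign and a power of `X`, a Gaussian binomial coefficient. -/
lemma tripleCoeff_mul_eulerProd {n k d : ℕ} (hn : n = k + d) :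
    tripleCoeff R n k * eulerProd R d * eulerProd R (n + k + 1) =
      (-1) ^ k * X ^ (k + 1).choose 2 * eulerProd R (2 * n + 1) := by
  induction n generalizing k d with
  | zero =>
    obtain ⟨rfl, rfl⟩ : k = 0 ∧ d = 0 := by omega
    simp [tripleCoeff, eulerProd_zero]
  | succ n ih =>
    rcases k with _ | k
    · obtain rfl : d = n + 1 := by omega
      have h0 := ih (k := 0) (d := n) (by omega)
      rw [show 2 * (n + 1) + 1 = 2 * n + 1 + 1 + 1 by ring, tripleCoeff]
      simp only [eulerProd_succ R (_ + 1), eulerProd_succ R n,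
        show Nat.choose (0 + 1) 2 = 0 by rfl, add_zero] at h0 ⊢
      rcases n with _ | m
      · simp [tripleCoeff, eulerProd_zero, show eulerProd R 1 = 1 - X by simp [eulerProd]]
        ring
      · have h1 := ih (k := 1) (d := m) (by omega)
        simp only [eulerProd_succ R (_ + 1), eulerProd_succ R m,
          show Nat.choose (1 + 1) 2 = 1 by rfl] at h0 h1 ⊢
        linear_combination
          (1 + X ^ (2 * (m + 1) + 2) + X ^ (m + 2)) * (1 - X ^ (m + 2)) * (1 - X ^ (m + 3)) * h0 -
          X ^ (m + 2) * (1 - X ^ (m + 1)) * (1 - X ^ (m + 2)) * h1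
    · have hA := ih (k := k) (d := d) (by omega)
      rw [show n + 1 + (k + 1) + 1 = n + k + 1 + 1 + 1 by ring,
        show 2 * (n + 1) + 1 = 2 * n + 1 + 1 + 1 by ring, tripleCoeff, succ_succ_choose_two]
      rcases d with _ | _ | d
      · obtain rfl : n = k := by omega
        rw [tripleCoeff_eq_zero R (by omega : n < n + 1),
          tripleCoeff_eq_zero R (by omega : n < n + 2)]
        simp only [eulerProd_succ R (_ + 1)]
        linear_combination
          -X ^ (n + 1) * (1 - X ^ (n + n + 1 + 1)) * (1 - X ^ (n + n + 1 + 1 + 1)) * hA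
      · have hB := ih (k := k + 1) (d := 0) (by omega)
        rw [tripleCoeff_eq_zero R (by omega : n < k + 2)]
        rw [show n + (k + 1) + 1 = n + k + 1 + 1 by ring, succ_succ_choose_two] at hB
        simp only [eulerProd_succ R (_ + 1), zero_add, eulerProd_succ R 0] at hA hB ⊢
        obtain rfl : n = k + 1 := by omega
        linear_combination
          (1 + X ^ (2 * (k + 1) + 2)) * (1 - X) * (1 - X ^ (2 * k + 4)) * hB -
          X ^ (k + 2) * (1 - X ^ (2 * k + 3)) * (1 - X ^ (2 * k + 4)) * hA
      · have hB := ih (k := k + 1) (d := d + 1) (by omega)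
        have hC := ih (k := k + 2) (d := d) (by omega)
        rw [show n + (k + 1) + 1 = n + k + 1 + 1 by ring, succ_succ_choose_two] at hB
        rw [show n + (k + 2) + 1 = n + k + 1 + 1 + 1 by ring, succ_succ_choose_two (k + 1),
          succ_succ_choose_two] at hC
        simp only [eulerProd_succ R (_ + 1), eulerProd_succ R d] at hA hB hC ⊢
        obtain rfl : n = k + d + 2 := by omega
        linear_combination
          (1 + X ^ (2 * (k + d + 2) + 2)) * (1 - X ^ (d + 2)) * (1 - X ^ (2 * k + d + 5)) * hB -
          X ^ (k + d + 3) * (1 - X ^ (2 * k + d + 4)) * (1 - X ^ (2 * k + d + 5)) * hA -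
          X ^ (k + d + 3) * (1 - X ^ (d + 1)) * (1 - X ^ (d + 2)) * hC

/-- The generating function of the partition numbers. -/
noncomputable def partitionSeries : R⟦X⟧ := .mk fun n ↦ (Fintype.card (Nat.Partition n) : R)

open PowerSeries.WithPiTopology in
lemma partitionSeries_mul_pentagonalSeries :
    partitionSeries R * pentagonalSeries R = 1 := by
  let _ : TopologicalSpace R := ⊥
  have : DiscreteTopology R := ⟨rfl⟩
  have hP : HasProd (fun i ↦ ∑' j : ℕ, X ^ ((i + 1) * j) : ℕ → R⟦X⟧) (partitionSeries R) := by
    simpa [Nat.Partition.restricted, partitionSeries] using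
      Nat.Partition.hasProd_powerSeriesMk_card_restricted R fun _ ↦ True
  refine ((hP.mul (hasProd_one_sub_X_pow R)).unique ?_)
  convert hasProd_one with i
  simp_rw [pow_mul]
  exact tsum_pow_mul_one_sub_of_constantCoeff_eq_zero (by simp)

lemma X_pow_dvd_eulerProd_sub_eulerProd {m n : ℕ} (h : m ≤ n) :
    X ^ (m + 1) ∣ eulerProd R n - eulerProd R m := by
  induction n, h using Nat.le_induction with
  | base => simp
  | succ n h ih =>
    rw [eulerProd_succ, show eulerProd R n * (1 - X ^ (n + 1)) - eulerProd R m =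
      (eulerProd R n - eulerProd R m) - X ^ (n + 1) * eulerProd R n by ring]
    exact dvd_sub ih (Dvd.dvd.mul_right (pow_dvd_pow _ (by omega)) _)

lemma X_pow_dvd_eulerProd_sub_pentagonalSeries (m : ℕ) :
    X ^ (m + 1) ∣ eulerProd R m - pentagonalSeries R := by
  refine X_pow_dvd_iff.mpr fun i hi ↦ ?_
  have hs := Filter.tendsto_finset_range.eventually (coeff_prod_one_sub_X_pow_eventually_eq R i)
  obtain ⟨n, hn, hmn⟩ := (hs.and (Filter.eventually_ge_atTop m)).exists
  have := X_pow_dvd_iff.mp (X_pow_dvd_eulerProd_sub_eulerProd R hmn) i hi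
  rw [map_sub, sub_eq_zero] at this ⊢
  rw [← this, ← hn, eulerProd]

lemma isUnit_eulerProd (m : ℕ) : IsUnit (eulerProd R m) := by
  rw [isUnit_iff_constantCoeff]
  simp [eulerProd, map_prod]

lemma X_pow_dvd_tripleCoeff_sub (N k : ℕ) :
    X ^ N ∣ tripleCoeff R (2 * N) k - (-1) ^ k * X ^ (k + 1).choose 2 * partitionSeries R := by
  have hT : k ≤ (k + 1).choose 2 := by
    rcases k with _ | k
    · simp
    · rw [succ_succ_choose_two]; omega
  by_cases hk : 2 * N < k
  · rw [tripleCoeff_eq_zero R hk, zero_sub, dvd_neg]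
    exact Dvd.dvd.mul_right (Dvd.dvd.mul_left (pow_dvd_pow _ (by omega)) _) _
  obtain ⟨d, hd⟩ := Nat.exists_eq_add_of_le (not_lt.mp hk)
  have h := tripleCoeff_mul_eulerProd R hd
  by_cases hkN : N < k
  · have hX : X ^ N ∣ (X : R⟦X⟧) ^ (k + 1).choose 2 := pow_dvd_pow _ (by omega)
    refine dvd_sub ?_ ((hX.mul_left _).mul_right _)
    rw [← (isUnit_eulerProd R d).dvd_mul_right,
      ← (isUnit_eulerProd R (2 * N + k + 1)).dvd_mul_right, h]
    exact (hX.mul_left _).mul_right _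
  have key (m : ℕ) (hm : N ≤ m) : ∃ f, eulerProd R m = pentagonalSeries R + X ^ N * f := by
    obtain ⟨f, hf⟩ := (pow_dvd_pow X (by omega : N ≤ m + 1)).trans
      (X_pow_dvd_eulerProd_sub_pentagonalSeries R m)
    exact ⟨f, by rw [← hf]; ring⟩
  obtain ⟨f, hf⟩ := key d (by omega)
  obtain ⟨g, hg⟩ := key (2 * N + k + 1) (by omega)
  obtain ⟨e, he⟩ := key (2 * (2 * N) + 1) (by omega)
  rw [hf, hg, he] at h
  have hPE := partitionSeries_mul_pentagonalSeries R
  generalize partitionSeries R = P at *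
  generalize pentagonalSeries R = E at *
  generalize tripleCoeff R (2 * N) k = c at *
  generalize (-1 : R⟦X⟧) ^ k * X ^ (k + 1).choose 2 = u at *
  refine ⟨P ^ 2 * (u * e - c * (E * f + E * g + X ^ N * f * g)), ?_⟩
  linear_combination P ^ 2 * h + (u * P - c * (P * E + 1)) * hPE

/-- A partial sum of the series `∑ (-1) ^ k * (2 * k + 1) * X ^ (k * (k + 1) / 2)`. -/
noncomputable def triangularSum (N : ℕ) : R⟦X⟧ :=
  ∑ k ∈ range (N + 1), (2 * k + 1 : R⟦X⟧) * ((-1) ^ k * X ^ (k + 1).choose 2)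

/-- **Jacobi's identity** for the cube of the Euler product, modulo `X ^ N`. -/
lemma X_pow_dvd_pentagonalSeries_pow_three_sub (N : ℕ) :
    X ^ N ∣ pentagonalSeries R ^ 3 - triangularSum R (2 * N) := by
  have hsum : X ^ N ∣ ∑ k ∈ range (2 * N + 1), (2 * k + 1 : R⟦X⟧) *
      (tripleCoeff R (2 * N) k - (-1) ^ k * X ^ (k + 1).choose 2 * partitionSeries R) :=
    dvd_sum fun k _ ↦ (X_pow_dvd_tripleCoeff_sub R N k).mul_left _
  simp_rw [mul_sub, sum_sub_distrib, sum_mul_tripleCoeff R le_rfl, ← mul_assoc _ _ (partitionSeries R),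
    ← sum_mul] at hsum
  rw [← triangularSum] at hsum
  have hE : X ^ N ∣ eulerProd R (2 * N) - pentagonalSeries R :=
    (pow_dvd_pow X (by omega)).trans (X_pow_dvd_eulerProd_sub_pentagonalSeries R (2 * N))
  obtain ⟨f, hf⟩ := hsum
  obtain ⟨g, hg⟩ := hE
  have hPE := partitionSeries_mul_pentagonalSeries R
  generalize partitionSeries R = P at *
  generalize pentagonalSeries R = E at *
  generalize eulerProd R (2 * N) = Q at *
  generalize triangularSum R (2 * N) = S at *
  refine ⟨f * E - E * g * (Q + E), ?_⟩
  linear_combination E * hf - E * (Q + E) * hg + S * hPE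

end JacobiIdentity

lemma coeff_pow_char_eq_zero (p : ℕ) [Fact p.Prime] (f : (ZMod p)⟦X⟧) {n : ℕ} (h : ¬ p ∣ n) :
    coeff n (f ^ p) = 0 := by
  obtain ⟨n, rfl⟩ := Nat.exists_eq_add_one_of_ne_zero (by rintro rfl; simp at h : n ≠ 0)
  have hd : d⁄dX (ZMod p) (f ^ p) = 0 := by
    rw [Derivation.leibniz_pow, ← Nat.cast_smul_eq_nsmul (ZMod p), CharP.cast_eq_zero, zero_smul]
  have := congrArg (coeff n) hd
  rw [coeff_derivative, map_zero] at this
  refine (mul_eq_zero.mp this).resolve_right fun h0 ↦ h ?_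
  rwa [← Nat.cast_add_one, ZMod.natCast_eq_zero_iff] at h0

lemma two_mul_succ_choose_two (k : ℕ) : 2 * (k + 1).choose 2 = k * (k + 1) := by
  induction k with
  | zero => rfl
  | succ k ih => rw [succ_succ_choose_two]; linarith

/-- `8 * (T_j + T_k) + 2 = (2 * j + 1) ^ 2 + (2 * k + 1) ^ 2` for triangular numbers `T_j`, `T_k`,
and `-1` is not a square modulo `7`. -/
lemma mul_eq_zero_of_choose_two_add_choose_two {j k : ℕ}
    (h : (((j + 1).choose 2 + (k + 1).choose 2 : ℕ) : ZMod 7) = 5) :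
    ((2 * j + 1) * (2 * k + 1) : ZMod 7) = 0 := by
  have hj := congrArg (Nat.cast (R := ZMod 7)) (two_mul_succ_choose_two j)
  have hk := congrArg (Nat.cast (R := ZMod 7)) (two_mul_succ_choose_two k)
  push_cast at h hj hk
  generalize (j : ZMod 7) = a at *
  generalize (k : ZMod 7) = b at *
  have hab : a * (a + 1) + b * (b + 1) = 3 := by
    rw [← hj, ← hk, ← mul_add, h]; rfl
  clear h hj hk
  revert a b
  decide

lemma coeff_triangularSum_sq_eq_zero (N : ℕ) {m : ℕ} (hm : (m : ZMod 7) = 5) :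
    coeff m (triangularSum (ZMod 7) N ^ 2) = 0 := by
  rw [triangularSum, sq, sum_mul_sum, map_sum]
  refine sum_eq_zero fun j _ ↦ ?_
  rw [map_sum]
  refine sum_eq_zero fun k _ ↦ ?_
  have : (2 * (j : (ZMod 7)⟦X⟧) + 1) * ((-1) ^ j * X ^ (j + 1).choose 2) *
      ((2 * (k : (ZMod 7)⟦X⟧) + 1) * ((-1) ^ k * X ^ (k + 1).choose 2)) =
      C (((2 * j + 1) * (2 * k + 1) : ZMod 7) * (-1) ^ (j + k)) *
        X ^ ((j + 1).choose 2 + (k + 1).choose 2) := by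
    simp only [map_mul, map_add, map_pow, map_neg, map_one, map_natCast, map_ofNat]
    ring
  rw [this, coeff_C_mul, coeff_X_pow]
  split_ifs with h
  · subst h
    rw [mul_eq_zero_of_choose_two_add_choose_two hm, zero_mul, zero_mul]
  · rw [mul_zero]

theorem ramanujan_congruence_mod_seven (n : ℕ) :
    7 ∣ Fintype.card (Nat.Partition (7 * n + 5)) := by
  have : Fact (Nat.Prime 7) := ⟨by norm_num⟩
  rw [← ZMod.natCast_eq_zero_iff]
  obtain ⟨f, hf⟩ := X_pow_dvd_pentagonalSeries_pow_three_sub (ZMod 7) (7 * n + 6)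
  have hPE := partitionSeries_mul_pentagonalSeries (ZMod 7)
  have hP : ((Fintype.card (Nat.Partition (7 * n + 5)) : ℕ) : ZMod 7) =
      coeff (7 * n + 5) (partitionSeries (ZMod 7)) := by rw [partitionSeries, coeff_mk]
  have hS {m : ℕ} (hm : (m : ZMod 7) = 5) := coeff_triangularSum_sq_eq_zero (2 * (7 * n + 6)) hm
  rw [hP]
  generalize partitionSeries (ZMod 7) = P at *
  generalize pentagonalSeries (ZMod 7) = E at *
  generalize triangularSum (ZMod 7) _ = S at *
  have hdecomp : P = P ^ 7 * S ^ 2 + X ^ (7 * n + 6) * (P ^ 7 * f * (E ^ 3 + S)) := by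
    have h6 : (P * E) ^ 6 = 1 := by rw [hPE, one_pow]
    linear_combination P ^ 7 * (E ^ 3 + S) * hf - P * h6
  rw [hdecomp, map_add, coeff_X_pow_mul', if_neg (by omega), add_zero, coeff_mul]
  refine sum_eq_zero fun ⟨a, b⟩ hab ↦ ?_
  rw [HasAntidiagonal.mem_antidiagonal] at hab
  by_cases ha : 7 ∣ a
  · rw [hS, mul_zero]
    have := congrArg (Nat.cast (R := ZMod 7)) hab
    push_cast at this
    rwa [(ZMod.natCast_eq_zero_iff a 7).mpr ha, zero_add, show (7 : ZMod 7) = 0 from rfl, zero_mul,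
      zero_add] at this
  · rw [coeff_pow_char_eq_zero 7 P ha, zero_mul]
end
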